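/- There exist 61 distinct points in ℝ² and a set E of 122 unordered pairs of these points such that every point is an endpoint of exactly 4 pairs in E, the closed segments of any two distinct pairs intersect at most in a common endpoint, exactly 119 of the pairs join points at distance exactly 1, two of the remaining pairs join points at one common distance t₁ with |t₁ − 1| < 0.04, and the last pair joins points at a distance t₂ with |t₂ − 1| < 0.02. -/

import Mathlib

open scoped Classical

/-- Scale of the fixed point arithmetic. -/
def SC : ℤ := 1000000000000

def nab (x : ℤ) : ℤ := (x.natAbs : ℤ)

theorem nab_eq (x : ℤ) : ((nab x : ℤ) : ℝ) = |(x : ℝ)| := by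
  unfold nab
  rw [Int.natCast_natAbs, Int.cast_abs]

def Ap (x : ℝ) (X E : ℤ) : Prop := |x * SC - X| ≤ E

def CA (z : ℂ) (X Y E : ℤ) : Prop := Ap z.re X E ∧ Ap z.im Y E

theorem SC_pos : (0 : ℝ) < SC := by norm_num [SC]

theorem Ap.pos {x : ℝ} {X E : ℤ} (h : Ap x X E) (hc : decide (E < X) = true) : 0 < x := by
  have hc : E < X := of_decide_eq_true hc
  have hc' : (E : ℝ) < X := by exact_mod_cast hc
  unfold Ap at h
  rw [abs_le] at h
  have : 0 < x * SC := by linarith [h.1]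
  exact pos_of_mul_pos_left this SC_pos.le

theorem Ap.add {x y : ℝ} {X E Y F : ℤ} (h : Ap x X E) (k : Ap y Y F) :
    Ap (x + y) (X + Y) (E + F) := by
  unfold Ap at *
  rw [abs_le] at *
  push_cast
  constructor <;> linarith [h.1, h.2, k.1, k.2]

theorem Ap.sub {x y : ℝ} {X E Y F : ℤ} (h : Ap x X E) (k : Ap y Y F) :
    Ap (x - y) (X - Y) (E + F) := by
  unfold Ap at *
  rw [abs_le] at *
  push_cast
  constructor <;> linarith [h.1, h.2, k.1, k.2]

theorem Ap.neg {x : ℝ} {X E : ℤ} (h : Ap x X E) : Ap (-x) (-X) E := by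
  unfold Ap at *
  rw [abs_le] at *
  push_cast
  constructor <;> linarith [h.1, h.2]

theorem Ap.zsmul {x : ℝ} {X E : ℤ} (n : ℤ) (h : Ap x X E) : Ap (n * x) (n * X) (nab n * E) := by
  unfold Ap at *
  push_cast
  rw [nab_eq, show (n : ℝ) * x * SC - n * X = n * (x * SC - X) by ring, abs_mul]
  exact mul_le_mul_of_nonneg_left h (abs_nonneg _)

theorem Ap.weak {x : ℝ} {X E : ℤ} (Y F : ℤ) (h : Ap x X E)
    (hc : decide (nab (X - Y) + E ≤ F) = true) : Ap x Y F := by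
  have hc' : ((nab (X - Y) + E : ℤ) : ℝ) ≤ F := by exact_mod_cast of_decide_eq_true hc
  push_cast at hc'
  rw [nab_eq] at hc'
  push_cast at hc'
  unfold Ap at *
  rw [show x * SC - Y = (x * SC - X) + (X - Y) by ring]
  exact (abs_add_le _ _).trans (by linarith)

/-- raw product, before rescaling -/
theorem raw_mul {x y : ℝ} {X E Y F : ℤ} (h : Ap x X E) (k : Ap y Y F) :
    |x * y * SC * SC - X * Y| ≤ |(X : ℝ)| * F + |(Y : ℝ)| * E + E * F := by
  unfold Ap at *
  rw [show x * y * SC * SC - X * Y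
    = X * (y * SC - Y) + Y * (x * SC - X) + (x * SC - X) * (y * SC - Y) by ring]
  refine (abs_add_three _ _ _).trans ?_
  rw [abs_mul, abs_mul, abs_mul]
  have h0 := abs_nonneg (x * SC - X)
  have h1 := abs_nonneg (y * SC - Y)
  gcongr
  exact h0.trans h

theorem fin_mul {p : ℝ} {M T Q G : ℤ} (h : |p * SC * SC - M| ≤ T)
    (hc : nab (M - Q * SC) + T ≤ G * SC) : Ap p Q G := by
  have hc' : ((nab (M - Q * SC) + T : ℤ) : ℝ) ≤ (G * SC : ℤ) := by exact_mod_cast hc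
  push_cast at hc'
  rw [nab_eq] at hc'
  push_cast at hc'
  unfold Ap
  have h1 : |p * SC - Q| * SC = |(p * SC * SC - M) + (M - Q * SC)| := by
    rw [show (p * SC * SC - M) + (M - Q * SC) = (p * SC - Q) * SC by ring, abs_mul,
      abs_of_pos SC_pos]
  have h2 : |p * SC - Q| * SC ≤ G * SC := by
    rw [h1]
    exact (abs_add_le _ _).trans (by linarith)
  exact le_of_mul_le_mul_right h2 SC_pos

theorem Ap.mul {x y : ℝ} {X E Y F : ℤ} (Q G : ℤ) (h : Ap x X E) (k : Ap y Y F)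
    (hc : decide (nab (X * Y - Q * SC) + (nab X * F + nab Y * E + E * F) ≤ G * SC) = true) :
    Ap (x * y) Q G := by
  refine fin_mul (M := X * Y) (T := nab X * F + nab Y * E + E * F) ?_ (of_decide_eq_true hc)
  push_cast
  rw [nab_eq, nab_eq]
  exact raw_mul h k

theorem Ap.div {x y : ℝ} {X E Y F : ℤ} (Q G : ℤ) (h : Ap x X E) (k : Ap y Y F)
    (hc : (decide (F < Y) && decide (0 ≤ G) &&
      decide (nab (X * SC - Q * Y) + (E * SC + nab Q * F) ≤ G * (Y - F))) = true) :
    Ap (x / y) Q G := by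
  simp only [Bool.and_eq_true, decide_eq_true_eq] at hc
  obtain ⟨⟨hFY, hG⟩, hc⟩ := hc
  have hy : 0 < y := k.pos (decide_eq_true hFY)
  have hFY' : (F : ℝ) < Y := by exact_mod_cast hFY
  have hG' : (0 : ℝ) ≤ G := by exact_mod_cast hG
  have hc' : ((nab (X * SC - Q * Y) + (E * SC + nab Q * F) : ℤ) : ℝ) ≤ (G * (Y - F) : ℤ) := by
    exact_mod_cast hc
  push_cast at hc'
  rw [nab_eq, nab_eq] at hc'
  push_cast at hc'
  unfold Ap at *
  have hx : x = x / y * y := by field_simp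
  generalize x / y = q at hx ⊢
  have e1 : (q * SC - Q) * (y * SC) = (x * SC - X) * SC + (X * SC - Q * Y) - Q * (y * SC - Y) := by
    rw [hx]; ring
  have e2 : |q * SC - Q| * (y * SC) ≤ E * SC + |(X * SC - Q * Y : ℝ)| + |(Q : ℝ)| * F := by
    have : |q * SC - Q| * (y * SC) = |(q * SC - Q) * (y * SC)| := by
      rw [abs_mul, abs_of_pos (mul_pos hy SC_pos)]
    rw [this, e1]
    refine (abs_sub _ _).trans ?_
    refine add_le_add ((abs_add_le _ _).trans (add_le_add ?_ le_rfl)) ?_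
    · rw [abs_mul, abs_of_pos SC_pos]
      exact mul_le_mul_of_nonneg_right h SC_pos.le
    · rw [abs_mul]
      exact mul_le_mul_of_nonneg_left k (abs_nonneg _)
  rw [abs_le] at k
  have e3 : |q * SC - Q| * (y * SC) ≤ G * (y * SC) := by
    refine e2.trans (le_trans (by linarith) (mul_le_mul_of_nonneg_left (b := (Y : ℝ) - F) ?_ hG'))
    linarith [k.1]
  exact le_of_mul_le_mul_right e3 (mul_pos hy SC_pos)

theorem Ap.sqrt {y : ℝ} {Y F : ℤ} (X E : ℤ) (k : Ap y Y F)
    (hc : (decide (0 ≤ X - E) && decide ((X - E) * (X - E) ≤ (Y - F) * SC) &&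
      decide ((Y + F) * SC ≤ (X + E) * (X + E)) && decide (0 ≤ E)) = true) :
    Ap (Real.sqrt y) X E := by
  simp only [Bool.and_eq_true, decide_eq_true_eq] at hc
  obtain ⟨⟨⟨h0, h1⟩, h2⟩, h3⟩ := hc
  have h0' : (0 : ℝ) ≤ X - E := by exact_mod_cast h0
  have h1' : ((X : ℝ) - E) * (X - E) ≤ (Y - F) * SC := by exact_mod_cast h1
  have h2' : ((Y : ℝ) + F) * SC ≤ (X + E) * (X + E) := by exact_mod_cast h2
  have h3' : (0 : ℝ) ≤ E := by exact_mod_cast h3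
  unfold Ap at *
  rw [abs_le] at *
  have hS := SC_pos
  have hyS : 0 ≤ y * SC := by
    have : 0 ≤ ((Y : ℝ) - F) * SC := (mul_self_nonneg _).trans h1'
    have := nonneg_of_mul_nonneg_left this hS
    linarith [k.1]
  have hy : 0 ≤ y := nonneg_of_mul_nonneg_left hyS hS
  have hs := Real.mul_self_sqrt hy
  have hs0 := Real.sqrt_nonneg y
  generalize Real.sqrt y = s at *
  have e : (s * SC) * (s * SC) = (y * SC) * SC := by rw [← hs]; ring
  have hsS : 0 ≤ s * SC := mul_nonneg hs0 hS.le
  have lo : ((X : ℝ) - E) * (X - E) ≤ (s * SC) * (s * SC) := by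
    rw [e]
    exact h1'.trans (mul_le_mul_of_nonneg_right (by linarith [k.1]) hS.le)
  have hi : (s * SC) * (s * SC) ≤ ((X : ℝ) + E) * (X + E) := by
    rw [e]
    exact le_trans (mul_le_mul_of_nonneg_right (by linarith [k.2]) hS.le) h2'
  have l1 : (X : ℝ) - E ≤ s * SC := le_of_not_gt fun hlt => absurd lo (not_le.mpr (by nlinarith))
  have l2 : s * SC ≤ (X : ℝ) + E := le_of_not_gt fun hlt => absurd hi (not_le.mpr (by nlinarith))
  constructor <;> linarith

def mulc (X Y E X' Y' E' R I G : ℤ) : Bool :=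
  let T := (nab X + nab Y) * E' + (nab X' + nab Y') * E + 2 * (E * E')
  decide (nab (X * X' - Y * Y' - R * SC) + T ≤ G * SC) &&
  decide (nab (X * Y' + Y * X' - I * SC) + T ≤ G * SC)

theorem CA.mul {z w : ℂ} {X Y E X' Y' E' : ℤ} (h : CA z X Y E) (k : CA w X' Y' E') (R I G : ℤ)
    (hc : mulc X Y E X' Y' E' R I G = true) : CA (z * w) R I G := by
  simp only [mulc, Bool.and_eq_true, decide_eq_true_eq] at hc
  have a1 := raw_mul h.1 k.1
  have a2 := raw_mul h.2 k.2
  have a3 := raw_mul h.1 k.2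
  have a4 := raw_mul h.2 k.1
  constructor
  · refine fin_mul ?_ hc.1
    push_cast
    simp only [nab_eq]
    rw [Complex.mul_re, show (z.re * w.re - z.im * w.im) * SC * SC - ((X : ℝ) * X' - Y * Y')
      = (z.re * w.re * SC * SC - X * X') - (z.im * w.im * SC * SC - Y * Y') by ring]
    exact (abs_sub _ _).trans (by linarith)
  · refine fin_mul ?_ hc.2
    push_cast
    simp only [nab_eq]
    rw [Complex.mul_im, show (z.re * w.im + z.im * w.re) * SC * SC - ((X : ℝ) * Y' + Y * X')
      = (z.re * w.im * SC * SC - X * Y') + (z.im * w.re * SC * SC - Y * X') by ring]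
    exact (abs_add_le _ _).trans (by linarith)

theorem CA.conj {z : ℂ} {X Y E : ℤ} (h : CA z X Y E) : CA ((starRingEnd ℂ) z) X (-Y) E := by
  refine ⟨?_, ?_⟩
  · rw [Complex.conj_re]; exact h.1
  · rw [Complex.conj_im]; exact h.2.neg

theorem CA.sub {z w : ℂ} {X Y E X' Y' E' : ℤ} (h : CA z X Y E) (k : CA w X' Y' E') :
    CA (z - w) (X - X') (Y - Y') (E + E') :=
  ⟨h.1.sub k.1, h.2.sub k.2⟩

theorem CA.add {z w : ℂ} {X Y E X' Y' E' : ℤ} (h : CA z X Y E) (k : CA w X' Y' E') :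
    CA (z + w) (X + X') (Y + Y') (E + E') :=
  ⟨h.1.add k.1, h.2.add k.2⟩

theorem CA.zsmul {z : ℂ} {X Y E : ℤ} (n : ℤ) (h : CA z X Y E) :
    CA (n * z) (n * X) (n * Y) (nab n * E) := by
  constructor
  · have := h.1.zsmul n
    simpa using this
  · have := h.2.zsmul n
    simpa using this

theorem CA.weak {z : ℂ} {X Y E : ℤ} (h : CA z X Y E) (R I G : ℤ)
    (hc : (decide (nab (X - R) + E ≤ G) && decide (nab (Y - I) + E ≤ G)) = true) : CA z R I G := by
  rw [Bool.and_eq_true] at hc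
  exact ⟨h.1.weak R G hc.1, h.2.weak I G hc.2⟩

theorem CA.nsq {z : ℂ} {X Y E : ℤ} (h : CA z X Y E) (R G : ℤ)
    (hc : mulc X Y E X (-Y) E R 0 G = true) : Ap (Complex.normSq z) R G := by
  have := (CA.mul h h.conj R 0 G hc).1
  rw [Complex.mul_conj, Complex.ofReal_re] at this
  exact this

theorem CA.divr {z : ℂ} {n : ℝ} {X Y E N F : ℤ} (h : CA z X Y E) (k : Ap n N F) (R I G : ℤ)
    (h1 : (decide (F < N) && decide (0 ≤ G) &&
      decide (nab (X * SC - R * N) + (E * SC + nab R * F) ≤ G * (N - F))) = true)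
    (h2 : (decide (F < N) && decide (0 ≤ G) &&
      decide (nab (Y * SC - I * N) + (E * SC + nab I * F) ≤ G * (N - F))) = true) :
    CA (z / (n : ℂ)) R I G := by
  constructor
  · rw [Complex.div_ofReal_re]; exact h.1.div R G k h1
  · rw [Complex.div_ofReal_im]; exact h.2.div I G k h2

theorem CA.imul {z : ℂ} {X Y E : ℤ} (h : CA z X Y E) : CA (Complex.I * z) (-Y) X E := by
  constructor
  · simpa using h.2.neg
  · simpa using h.1

/-- sixth root of unity -/
noncomputable def om : ℂ := ⟨1 / 2, Real.sqrt 3 / 2⟩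

theorem om_sq : om * om = om - 1 := by
  have := Real.mul_self_sqrt (show (0 : ℝ) ≤ 3 by norm_num)
  apply Complex.ext
  · simp [om]; nlinarith
  · simp [om]; ring

theorem om_conj : (starRingEnd ℂ) om = 1 - om := by
  apply Complex.ext
  · simp [om]; norm_num
  · simp [om]

theorem om_norm : ‖om‖ = 1 := by
  have h : om * (starRingEnd ℂ) om = 1 := by rw [om_conj, mul_sub, om_sq]; ring
  rw [Complex.mul_conj] at h
  have h : Complex.normSq om = 1 := by exact_mod_cast h
  rw [Complex.norm_def, h, Real.sqrt_one]

abbrev Row := List (ℤ × ℤ)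

noncomputable def val : Row → List ℂ → ℂ
  | p :: l, z :: zs => ((p.1 : ℂ) * z + (p.2 : ℂ) * (z * om)) + val l zs
  | _, _ => 0

def rsub : Row → Row → Row
  | [], m => m.map fun p => (-p.1, -p.2)
  | l, [] => l
  | p :: l, q :: m => (p.1 - q.1, p.2 - q.2) :: rsub l m

theorem val_nil (zs : List ℂ) : val [] zs = 0 := by
  cases zs <;> rfl

theorem val_neg (l : Row) (zs : List ℂ) : val (l.map fun p => (-p.1, -p.2)) zs = - val l zs := by
  induction l generalizing zs with
  | nil => simp [val_nil]
  | cons p l ih =>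
    cases zs with
    | nil => simp [val]
    | cons z zs => simp only [List.map_cons, val, ih]; push_cast; ring

theorem val_sub (l m : Row) (zs : List ℂ) : val (rsub l m) zs = val l zs - val m zs := by
  induction l generalizing m zs with
  | nil => simp [rsub, val_neg, val_nil]
  | cons p l ih =>
    cases m with
    | nil => simp [rsub, val_nil]
    | cons q m =>
      cases zs with
      | nil => simp [val]
      | cons z zs => simp only [rsub, val, ih]; push_cast; ring

def rom (l : Row) : Row := l.map fun p => (-p.2, p.1 + p.2)

theorem val_rom (l : Row) (zs : List ℂ) : val (rom l) zs = om * val l zs := by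
  induction l generalizing zs with
  | nil => simp [rom, val_nil]
  | cons p l ih =>
    cases zs with
    | nil => simp [rom, val]
    | cons z zs =>
      have e : rom (p :: l) = (-p.2, p.1 + p.2) :: rom l := rfl
      rw [e]
      simp only [val, ih]
      push_cast
      linear_combination (-(p.2 : ℂ) * z) * om_sq

theorem norm_rom (l : Row) (zs : List ℂ) : ‖val (rom l) zs‖ = ‖val l zs‖ := by
  rw [val_rom, norm_mul, om_norm, one_mul]

structure BA where
  (x y u v e : ℤ)

def CB (z : ℂ) (b : BA) : Prop := CA z b.x b.y b.e ∧ CA (z * om) b.u b.v b.e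

def apX : Row → List BA → ℤ
  | p :: l, b :: bs => (p.1 * b.x + p.2 * b.u) + apX l bs
  | _, _ => 0

def apY : Row → List BA → ℤ
  | p :: l, b :: bs => (p.1 * b.y + p.2 * b.v) + apY l bs
  | _, _ => 0

def apE : Row → List BA → ℤ
  | p :: l, b :: bs => (nab p.1 * b.e + nab p.2 * b.e) + apE l bs
  | _, _ => 0

theorem CA_zero : CA 0 0 0 0 := by
  constructor <;> simp [Ap]

theorem val_apx {zs : List ℂ} {bs : List BA} (h : List.Forall₂ CB zs bs) (l : Row) :
    CA (val l zs) (apX l bs) (apY l bs) (apE l bs) := by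
  induction h generalizing l with
  | nil =>
    have e1 : val l [] = 0 := by cases l <;> rfl
    have e2 : apX l [] = 0 := by cases l <;> rfl
    have e3 : apY l [] = 0 := by cases l <;> rfl
    have e4 : apE l [] = 0 := by cases l <;> rfl
    rw [e1, e2, e3, e4]; exact CA_zero
  | cons hb _ ih =>
    cases l with
    | nil => exact CA_zero
    | cons p l => exact ((hb.1.zsmul p.1).add (hb.2.zsmul p.2)).add (ih l)

def apc (l : Row) (bs : List BA) (R I G : ℤ) : Bool :=
  decide (nab (apX l bs - R) + apE l bs ≤ G) && decide (nab (apY l bs - I) + apE l bs ≤ G)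

theorem val_CA {zs : List ℂ} {bs : List BA} (h : List.Forall₂ CB zs bs) (l : Row) (R I G : ℤ)
    (hc : apc l bs R I G = true) : CA (val l zs) R I G :=
  (val_apx h l).weak R I G hc

/-- circle intersection -/
noncomputable def cx (A : ℂ) (p q : ℝ) : ℝ :=
  (Complex.normSq A + p - q) / (Complex.normSq A + Complex.normSq A)

noncomputable def cy2 (A : ℂ) (p q : ℝ) : ℝ := p / Complex.normSq A - cx A p q * cx A p q

theorem circ {A : ℂ} {p q y : ℝ} (hA : 0 < Complex.normSq A) (hy : y * y = cy2 A p q) :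
    Complex.normSq (A * ⟨cx A p q, y⟩) = p ∧ Complex.normSq (A * ⟨cx A p q, y⟩ - A) = q := by
  have e2 : A * ⟨cx A p q, y⟩ - A = A * ⟨cx A p q - 1, y⟩ := by
    apply Complex.ext <;> simp <;> ring
  rw [e2, Complex.normSq_mul, Complex.normSq_mul, Complex.normSq_mk (cx A p q) y,
    Complex.normSq_mk (cx A p q - 1) y]
  have h1 : cx A p q * (2 * Complex.normSq A) = Complex.normSq A + p - q := by
    unfold cx; field_simp; ring
  have h2 : Complex.normSq A * (y * y) = p - Complex.normSq A * (cx A p q * cx A p q) := by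
    rw [hy]; unfold cy2; field_simp
  constructor
  · linear_combination h2
  · linear_combination h2 - h1

theorem a_c3 : Ap ((3 : ℝ)) 3000000000000 0 :=
  by norm_num [Ap, SC, abs_le]

theorem a_s3 : Ap (Real.sqrt 3) 1732050807569 1 :=
  a_c3.sqrt _ _ (by decide +kernel)

theorem a_c2 : Ap ((2 : ℝ)) 2000000000000 0 :=
  by norm_num [Ap, SC, abs_le]

theorem a_half : Ap ((1 / 2 : ℝ)) 500000000000 0 :=
  by norm_num [Ap, SC, abs_le]

theorem a_s32 : Ap (Real.sqrt 3 / 2) 866025403784 1 :=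
  a_s3.div _ _ a_c2 (by decide +kernel)

theorem a_om : CA (om) 500000000000 866025403784 1 :=
  ⟨a_half.weak _ _ (by decide +kernel), a_s32.weak _ _ (by decide +kernel)⟩

theorem a_c15 : Ap ((15 : ℝ)) 15000000000000 0 :=
  by norm_num [Ap, SC, abs_le]

theorem a_s15 : Ap (Real.sqrt 15) 3872983346207 1 :=
  a_c15.sqrt _ _ (by decide +kernel)

theorem a_c8 : Ap ((8 : ℝ)) 8000000000000 0 :=
  by norm_num [Ap, SC, abs_le]

theorem a_c78 : Ap ((7 / 8 : ℝ)) 875000000000 0 :=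
  by norm_num [Ap, SC, abs_le]

theorem a_s158 : Ap (Real.sqrt 15 / 8) 484122918276 1 :=
  a_s15.div _ _ a_c8 (by decide +kernel)

noncomputable def kp : ℂ := ⟨7 / 8, Real.sqrt 15 / 8⟩

theorem a_kp : CA (kp) 875000000000 484122918276 1 :=
  ⟨a_c78.weak _ _ (by decide +kernel), a_s158.weak _ _ (by decide +kernel)⟩

noncomputable def kb : ℂ := (starRingEnd ℂ) kp

theorem a_kb : CA (kb) 875000000000 (-484122918276) 1 :=
  a_kp.conj

theorem a_c0 : Ap ((0 : ℝ)) 0 0 :=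
  by norm_num [Ap, SC, abs_le]

theorem a_c1 : Ap ((1 : ℝ)) 1000000000000 0 :=
  by norm_num [Ap, SC, abs_le]

theorem a_ch : Ap ((3 / 20 : ℝ)) 150000000000 0 :=
  by norm_num [Ap, SC, abs_le]

theorem a_cnh : Ap ((-3 / 20 : ℝ)) (-150000000000) 0 :=
  by norm_num [Ap, SC, abs_le]

theorem a_e1 : CA ((1 : ℂ)) 1000000000000 0 0 :=
  ⟨a_c1.weak _ _ (by decide +kernel), a_c0.weak _ _ (by decide +kernel)⟩

theorem a_e1_o : CA ((1 : ℂ) * om) 500000000000 866025403784 1 :=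
  a_e1.mul a_om _ _ _ (by decide +kernel)

theorem b_e1 : CB ((1 : ℂ)) ⟨1000000000000, 0, 500000000000, 866025403784, 1⟩ :=
  ⟨a_e1.weak _ _ _ (by decide +kernel), a_e1_o.weak _ _ _ (by decide +kernel)⟩

theorem a_kb_o : CA (kb * om) 856762745781 515710769173 3 :=
  a_kb.mul a_om _ _ _ (by decide +kernel)

theorem b_kb : CB (kb) ⟨875000000000, -484122918276, 856762745781, 515710769173, 3⟩ :=
  ⟨a_kb.weak _ _ _ (by decide +kernel), a_kb_o.weak _ _ _ (by decide +kernel)⟩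

theorem a_kp_o : CA (kp * om) 18237254219 999833687449 3 :=
  a_kp.mul a_om _ _ _ (by decide +kernel)

theorem b_kp : CB (kp) ⟨875000000000, 484122918276, 18237254219, 999833687449, 3⟩ :=
  ⟨a_kp.weak _ _ _ (by decide +kernel), a_kp_o.weak _ _ _ (by decide +kernel)⟩

noncomputable def hI : ℂ := ⟨0, 3 / 20⟩

theorem a_hI : CA (hI) 0 150000000000 0 :=
  ⟨a_c0.weak _ _ (by decide +kernel), a_ch.weak _ _ (by decide +kernel)⟩

theorem a_hI_o : CA (hI * om) (-129903810568) 75000000000 1 :=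
  a_hI.mul a_om _ _ _ (by decide +kernel)

theorem b_hI : CB (hI) ⟨0, 150000000000, -129903810568, 75000000000, 1⟩ :=
  ⟨a_hI.weak _ _ _ (by decide +kernel), a_hI_o.weak _ _ _ (by decide +kernel)⟩

theorem a_k2 : Ap ((1191 / 1636 : ℝ)) 727995110024 1 :=
  by norm_num [Ap, SC, abs_le]

theorem a_k1 : Ap (Real.sqrt (1191 / 1636)) 853226294733 1 :=
  a_k2.sqrt _ _ (by decide +kernel)

theorem a_g1 : CA (⟨1 / 2, Real.sqrt (1191 / 1636)⟩) 500000000000 853226294733 1 :=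
  ⟨a_half.weak _ _ (by decide +kernel), a_k1.weak _ _ (by decide +kernel)⟩

theorem a_g2 : CA (⟨1, -3 / 20⟩) 1000000000000 (-150000000000) 0 :=
  ⟨a_c1.weak _ _ (by decide +kernel), a_cnh.weak _ _ (by decide +kernel)⟩

noncomputable def sg : ℂ := ⟨1, -3 / 20⟩ * ⟨1 / 2, Real.sqrt (1191 / 1636)⟩

theorem a_sg : CA (sg) 627983944210 778226294733 2 :=
  a_g2.mul a_g1 _ _ _ (by decide +kernel)

theorem a_sg_o : CA (sg * om) (-359971769027) 932963196221 5 :=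
  a_sg.mul a_om _ _ _ (by decide +kernel)

theorem b_sg : CB (sg) ⟨627983944210, 778226294733, -359971769027, 932963196221, 5⟩ :=
  ⟨a_sg.weak _ _ _ (by decide +kernel), a_sg_o.weak _ _ _ (by decide +kernel)⟩

noncomputable def v_A : ℂ := val [(0, -2), (2, 1)] [1, kb]

theorem a_A : CA (v_A) 1606762745781 (-2184585874947) 11 :=
  val_CA (.cons b_e1 (.cons b_kb .nil)) _ _ _ _ (by decide +kernel)

noncomputable def v_b : ℂ := val [(-1, 0), (-1, 0), (-1, -1)] [1, hI, sg]

theorem a_b : CA (v_b) (-1268012175183) (-1861189490955) 13 :=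
  val_CA (.cons b_e1 (.cons b_hI (.cons b_sg .nil))) _ _ _ _ (by decide +kernel)

theorem a_n_A : Ap (Complex.normSq v_A) 7354101966250 86 :=
  a_A.nsq _ _ (by decide +kernel)

theorem a_n_b : Ap (Complex.normSq v_b) 5071881197652 84 :=
  a_b.nsq _ _ (by decide +kernel)

theorem a_p1 : Ap (Complex.normSq v_A + Complex.normSq v_b) 12425983163902 170 :=
  a_n_A.add a_n_b

theorem a_p2 : Ap (Complex.normSq v_A + Complex.normSq v_b - 1) 11425983163902 170 :=
  a_p1.sub a_c1

theorem a_p3 : Ap (Complex.normSq v_A + Complex.normSq v_A) 14708203932500 172 :=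
  a_n_A.add a_n_A

theorem a_px : Ap (cx v_A (Complex.normSq v_b) (1)) 776844216761 21 :=
  a_p2.div _ _ a_p3 (by decide +kernel)

theorem a_p4 : Ap (cx v_A (Complex.normSq v_b) (1) * cx v_A (Complex.normSq v_b) (1)) 603486937115 33 :=
  a_px.mul _ _ a_px (by decide +kernel)

theorem a_p5 : Ap (Complex.normSq v_b / Complex.normSq v_A) 689666966943 20 :=
  a_n_b.div _ _ a_n_A (by decide +kernel)

theorem a_p6 : Ap (cy2 v_A (Complex.normSq v_b) (1)) 86180029828 53 :=
  a_p5.sub a_p4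

theorem a_p7 : Ap (Real.sqrt (cy2 v_A (Complex.normSq v_b) (1))) 293564353810 91 :=
  a_p6.sqrt _ _ (by decide +kernel)

theorem a_pw : CA (⟨cx v_A (Complex.normSq v_b) (1), Real.sqrt (cy2 v_A (Complex.normSq v_b) (1))⟩) 776844216761 293564353810 91 :=
  ⟨a_px.weak _ _ (by decide +kernel), a_p7.weak _ _ (by decide +kernel)⟩

noncomputable def v_z : ℂ := v_A * ⟨cx v_A (Complex.normSq v_b) (1), Real.sqrt (cy2 v_A (Complex.normSq v_b) (1))⟩

theorem a_z : CA (v_z) 1889520887489 (-1225394635779) 358 :=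
  a_A.mul a_pw _ _ _ (by decide +kernel)

theorem a_bc : CA ((starRingEnd ℂ) v_b) (-1268012175183) 1861189490955 13 :=
  a_b.conj

theorem a_zb : CA (v_z * (starRingEnd ℂ) v_b) (-115243872215) 5070571736305 1162 :=
  a_z.mul a_bc _ _ _ (by decide +kernel)

noncomputable def rr : ℂ := v_z * (starRingEnd ℂ) v_b / (Complex.normSq v_b : ℂ)

theorem a_rr : CA (rr) (-22722115863) 999741819397 246 :=
  a_zb.divr a_n_b _ _ _ (by decide +kernel) (by decide +kernel)

theorem a_rr_o : CA (rr * om) (-877162870755) 480192980134 338 :=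
  a_rr.mul a_om _ _ _ (by decide +kernel)

theorem b_rr : CB (rr) ⟨-22722115863, 999741819397, -877162870755, 480192980134, 338⟩ :=
  ⟨a_rr.weak _ _ _ (by decide +kernel), a_rr_o.weak _ _ _ (by decide +kernel)⟩

theorem a_hr : CA (hI * rr) (-149961272910) (-3408317379) 38 :=
  a_hI.mul a_rr _ _ _ (by decide +kernel)

theorem a_hr_o : CA ((hI * rr) * om) (-72028947020) (-131574430613) 53 :=
  a_hr.mul a_om _ _ _ (by decide +kernel)

theorem b_hr : CB ((hI * rr)) ⟨-149961272910, -3408317379, -72028947020, -131574430613, 53⟩ :=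
  ⟨a_hr.weak _ _ _ (by decide +kernel), a_hr_o.weak _ _ _ (by decide +kernel)⟩

theorem a_sr : CA (sg * rr) (-792294495739) 610138862900 349 :=
  a_sg.mul a_rr _ _ _ (by decide +kernel)

theorem a_sr_o : CA ((sg * rr) * om) (-924543002977) (-381077729139) 479 :=
  a_sr.mul a_om _ _ _ (by decide +kernel)

theorem b_sr : CB ((sg * rr)) ⟨-792294495739, 610138862900, -924543002977, -381077729139, 479⟩ :=
  ⟨a_sr.weak _ _ _ (by decide +kernel), a_sr_o.weak _ _ _ (by decide +kernel)⟩

noncomputable def v_D : ℂ := val [(2, 2), (-2, 0), (1, -2), (-1, 0), (-1, -1)] [1, kb, rr, hI * rr, sg * rr]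

theorem a_D : CA (v_D) 4848402397273 2513999686869 2037 :=
  val_CA (.cons b_e1 (.cons b_kb (.cons b_rr (.cons b_hr (.cons b_sr .nil))))) _ _ _ _ (by decide +kernel)

noncomputable def v_d : ℂ := val [(2, -2), (-4, -2)] [1, kp]

theorem a_d : CA (v_d) (-2536474508438) (-5668209855571) 23 :=
  val_CA (.cons b_e1 (.cons b_kp .nil)) _ _ _ _ (by decide +kernel)

noncomputable def v_e : ℂ := val [(2, 2), (0, -2)] [1, kp]

theorem a_e : CA (v_e) 2963525491562 (-267616567330) 10 :=
  val_CA (.cons b_e1 (.cons b_kp .nil)) _ _ _ _ (by decide +kernel)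

noncomputable def v_g : ℂ := val [(0, -2), (-2, 0)] [1, kp]

theorem a_g : CA (v_g) (-2750000000000) (-2700296644121) 9 :=
  val_CA (.cons b_e1 (.cons b_kp .nil)) _ _ _ _ (by decide +kernel)

theorem a_n_D : Ap (Complex.normSq v_D) 29827200231456 29999 :=
  a_D.nsq _ _ (by decide +kernel)

theorem a_n_d : Ap (Complex.normSq v_d) 38562305898749 379 :=
  a_d.nsq _ _ (by decide +kernel)

theorem a_n_e : Ap (Complex.normSq v_e) 8854101966250 68 :=
  a_e.nsq _ _ (by decide +kernel)

theorem a_ec : CA ((starRingEnd ℂ) v_e) 2963525491562 267616567330 10 :=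
  a_e.conj

theorem a_ge : CA (v_g * (starRingEnd ℂ) v_e) (-7427050983125) (-8738343499789) 86 :=
  a_g.mul a_ec _ _ _ (by decide +kernel)

noncomputable def JJ : ℝ := -(v_g * (starRingEnd ℂ) v_e).im

theorem a_JJ : Ap (JJ) 8738343499789 86 :=
  a_ge.2.neg

theorem a_J2 : Ap (JJ + JJ) 17476686999578 172 :=
  a_JJ.add a_JJ

theorem a_J3 : Ap ((JJ + JJ) * (JJ + JJ)) 305434588481236 6030 :=
  a_J2.mul _ _ a_J2 (by decide +kernel)

noncomputable def pp : ℝ := (JJ + JJ) * (JJ + JJ) / Complex.normSq v_e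

theorem a_pp : Ap (pp) 34496393834801 948 :=
  a_J3.div _ _ a_n_e (by decide +kernel)

theorem a_q1 : Ap (Complex.normSq v_D + pp) 64323594066257 30947 :=
  a_n_D.add a_pp

theorem a_q2 : Ap (Complex.normSq v_D + pp - Complex.normSq v_d) 25761288167508 31326 :=
  a_q1.sub a_n_d

theorem a_q3 : Ap (Complex.normSq v_D + Complex.normSq v_D) 59654400462912 59998 :=
  a_n_D.add a_n_D

theorem a_qx : Ap (cx v_D (pp) (Complex.normSq v_d)) 431842210593 960 :=
  a_q2.div _ _ a_q3 (by decide +kernel)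

theorem a_q4 : Ap (cx v_D (pp) (Complex.normSq v_d) * cx v_D (pp) (Complex.normSq v_d)) 186487694850 830 :=
  a_qx.mul _ _ a_qx (by decide +kernel)

theorem a_q5 : Ap (pp / Complex.normSq v_D) 1156541464405 1196 :=
  a_pp.div _ _ a_n_D (by decide +kernel)

theorem a_q6 : Ap (cy2 v_D (pp) (Complex.normSq v_d)) 970053769555 2026 :=
  a_q5.sub a_q4

theorem a_q7 : Ap (Real.sqrt (cy2 v_D (pp) (Complex.normSq v_d))) 984913077157 1029 :=
  a_q6.sqrt _ _ (by decide +kernel)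

theorem a_q8 : Ap (-Real.sqrt (cy2 v_D (pp) (Complex.normSq v_d))) (-984913077157) 1029 :=
  a_q7.neg

theorem a_qw : CA (⟨cx v_D (pp) (Complex.normSq v_d), -Real.sqrt (cy2 v_D (pp) (Complex.normSq v_d))⟩) 431842210593 (-984913077157) 1029 :=
  ⟨a_qx.weak _ _ (by decide +kernel), a_q8.weak _ _ (by decide +kernel)⟩

noncomputable def v_C : ℂ := v_D * ⟨cx v_D (pp) (Complex.normSq v_d), -Real.sqrt (cy2 v_D (pp) (Complex.normSq v_d))⟩

theorem a_C : CA (v_C) 4569815976649 (-3689603742187) 10463 :=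
  a_D.mul a_qw _ _ _ (by decide +kernel)

theorem a_CD : CA (v_C - v_D) (-278586420624) (-6203603429056) 12500 :=
  a_C.sub a_D

theorem a_dc : CA ((starRingEnd ℂ) v_d) (-2536474508438) 5668209855571 23 :=
  a_d.conj

theorem a_CDd : CA ((v_C - v_D) * (starRingEnd ℂ) v_d) 35869953450939 14156195663249 102709 :=
  a_CD.mul a_dc _ _ _ (by decide +kernel)

noncomputable def ua : ℂ := (v_C - v_D) * (starRingEnd ℂ) v_d / (Complex.normSq v_d : ℂ)

theorem a_ua : CA (ua) 930181756898 367099304186 2673 :=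
  a_CDd.divr a_n_d _ _ _ (by decide +kernel) (by decide +kernel)

theorem a_Ce : CA (v_C * (starRingEnd ℂ) v_e) 14530165226841 (-9711276278736) 33893 :=
  a_C.mul a_ec _ _ _ (by decide +kernel)

theorem a_Cf : CA (v_C * v_e) 12555367050258 (-12157193208736) 33894 :=
  a_C.mul a_e _ _ _ (by decide +kernel)

theorem a_Ce2 : CA (Complex.I * (v_C * (starRingEnd ℂ) v_e)) 9711276278736 14530165226841 33893 :=
  a_Ce.imul

theorem a_Cf2 : CA (Complex.I * (v_C * v_e)) 12157193208736 12555367050258 33894 :=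
  a_Cf.imul

noncomputable def ub : ℂ := Complex.I * (v_C * (starRingEnd ℂ) v_e) / ((JJ + JJ : ℝ) : ℂ)

theorem a_ub : CA (ub) 555670321210 831402726798 1948 :=
  a_Ce2.divr a_J2 _ _ _ (by decide +kernel) (by decide +kernel)

noncomputable def uc : ℂ := Complex.I * (v_C * v_e) / ((JJ + JJ : ℝ) : ℂ)

theorem a_uc : CA (uc) 695623444479 718406586475 1947 :=
  a_Cf2.divr a_J2 _ _ _ (by decide +kernel) (by decide +kernel)

theorem a_ua_o : CA (ua * om) 147173555312 989110683704 3654 :=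
  a_ua.mul a_om _ _ _ (by decide +kernel)

theorem b_ua : CB (ua) ⟨930181756898, 367099304186, 147173555312, 989110683704, 3654⟩ :=
  ⟨a_ua.weak _ _ _ (by decide +kernel), a_ua_o.weak _ _ _ (by decide +kernel)⟩

theorem a_kua : CA (kp * ua) 636187850846 771534197840 3635 :=
  a_kp.mul a_ua _ _ _ (by decide +kernel)

theorem a_kua_o : CA ((kp * ua) * om) (-350074289794) 936721939331 4968 :=
  a_kua.mul a_om _ _ _ (by decide +kernel)

theorem b_kua : CB ((kp * ua)) ⟨636187850846, 771534197840, -350074289794, 936721939331, 4968⟩ :=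
  ⟨a_kua.weak _ _ _ (by decide +kernel), a_kua_o.weak _ _ _ (by decide +kernel)⟩

theorem a_ub_o : CA (ub * om) (-442180721578) 896925977696 2664 :=
  a_ub.mul a_om _ _ _ (by decide +kernel)

theorem b_ub : CB (ub) ⟨555670321210, 831402726798, -442180721578, 896925977696, 2664⟩ :=
  ⟨a_ub.weak _ _ _ (by decide +kernel), a_ub_o.weak _ _ _ (by decide +kernel)⟩

theorem a_kub : CA (kp * ub) 83710416699 996490123451 2650 :=
  a_kp.mul a_ub _ _ _ (by decide +kernel)

theorem a_kub_o : CA ((kp * ub) * om) (-821130553180) 570740409148 3623 :=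
  a_kub.mul a_om _ _ _ (by decide +kernel)

theorem b_kub : CB ((kp * ub)) ⟨83710416699, 996490123451, -821130553180, 570740409148, 3623⟩ :=
  ⟨a_kub.weak _ _ _ (by decide +kernel), a_kub_o.weak _ _ _ (by decide +kernel)⟩

theorem a_uc_o : CA (uc * om) (-274346631894) 961630867625 2663 :=
  a_uc.mul a_om _ _ _ (by decide +kernel)

theorem b_uc : CB (uc) ⟨695623444479, 718406586475, -274346631894, 961630867625, 2663⟩ :=
  ⟨a_uc.weak _ _ _ (by decide +kernel), a_uc_o.weak _ _ _ (by decide +kernel)⟩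

theorem a_kuc : CA (kb * uc) 956467607072 291838511203 2648 :=
  a_kb.mul a_uc _ _ _ (by decide +kernel)

theorem a_kuc_o : CA ((kb * uc) * om) 225494239032 974244501223 3620 :=
  a_kuc.mul a_om _ _ _ (by decide +kernel)

theorem b_kuc : CB ((kb * uc)) ⟨956467607072, 291838511203, 225494239032, 974244501223, 3620⟩ :=
  ⟨a_kuc.weak _ _ _ (by decide +kernel), a_kuc_o.weak _ _ _ (by decide +kernel)⟩

noncomputable def ZS : List ℂ :=
  [1, kb, rr, hI * rr, sg * rr, ua, kp * ua, ub, kp * ub, uc, kb * uc]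

def BS : List BA :=
  [⟨1000000000000, 0, 500000000000, 866025403784, 1⟩,
   ⟨875000000000, -484122918276, 856762745781, 515710769173, 3⟩,
   ⟨-22722115863, 999741819397, -877162870755, 480192980134, 338⟩,
   ⟨-149961272910, -3408317379, -72028947020, -131574430613, 53⟩,
   ⟨-792294495739, 610138862900, -924543002977, -381077729139, 479⟩,
   ⟨930181756898, 367099304186, 147173555312, 989110683704, 3654⟩,
   ⟨636187850846, 771534197840, -350074289794, 936721939331, 4968⟩,
   ⟨555670321210, 831402726798, -442180721578, 896925977696, 2664⟩,
   ⟨83710416699, 996490123451, -821130553180, 570740409148, 3623⟩,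
   ⟨695623444479, 718406586475, -274346631894, 961630867625, 2663⟩,
   ⟨956467607072, 291838511203, 225494239032, 974244501223, 3620⟩]

theorem ZB : List.Forall₂ CB ZS BS :=
  .cons b_e1 (.cons b_kb (.cons b_rr (.cons b_hr (.cons b_sr (.cons b_ua (.cons b_kua (.cons b_ub (.cons b_kub (.cons b_uc (.cons b_kuc .nil))))))))))

def r0 (a b c d e f g h i j : ℤ) : Row :=
  [(a, b), (c, d), (e, f), (g, h), (i, j), (0, 0), (0, 0), (0, 0), (0, 0), (0, 0), (0, 0)]

def ra (a b c d : ℤ) : Row :=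
  [(2, 2), (-2, 0), (1, -2), (-1, 0), (-1, -1), (a, b), (c, d), (0, 0), (0, 0), (0, 0), (0, 0)]

def rc (a b c d e f g h : ℤ) : Row :=
  [(0, 0), (0, 0), (0, 0), (0, 0), (0, 0), (0, 0), (0, 0), (a, b), (c, d), (e, f), (g, h)]

def rb (a b c d : ℤ) : Row := rc a b c d 0 0 0 0

/-- the vertices -/
def RL : List Row :=
  [r0 2 2 (-2) 0 0 (-1) (-1) 0 (-1) (-1), r0 2 2 (-2) 0 1 (-1) (-1) 0 (-1) (-1),
   r0 2 2 (-2) 0 0 0 (-1) 0 (-1) (-1), r0 2 2 (-2) 0 (-1) 0 (-1) 0 (-1) (-1),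
   r0 0 0 0 0 0 0 0 0 0 0, r0 2 2 (-2) 0 1 0 (-1) 0 (-1) (-1), r0 2 2 (-2) 0 0 0 0 0 (-1) (-1),
   r0 2 0 0 1 0 0 0 0 0 0, r0 1 0 0 0 0 0 0 0 0 0, r0 0 1 0 0 0 0 0 0 0 0,
   r0 2 2 (-2) 0 0 0 0 0 0 (-1), r0 2 2 (-2) 0 0 0 0 0 (-1) 0, r0 2 0 (-1) 2 0 0 0 0 0 0,
   r0 2 0 (-1) 1 0 0 0 0 0 0, r0 2 0 0 0 0 0 0 0 0 0, r0 1 1 0 0 0 0 0 0 0 0,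
   r0 0 2 0 0 0 0 0 0 0 0, r0 2 2 (-2) 0 0 0 0 0 0 0, r0 2 0 (-2) 2 0 0 0 0 0 0, ra 0 0 0 0,
   ra 1 (-2) (-2) 0, ra 1 (-1) (-2) 0, ra 0 (-1) (-2) 0, ra 0 (-2) (-2) 0, ra 2 (-2) (-2) 0,
   ra 0 0 (-2) 0, ra 2 0 (-2) (-2), ra 0 0 0 (-2), ra 0 0 (-1) (-1), ra 0 0 (-1) 0,
   ra 0 0 0 (-1), ra 1 0 (-2) (-2), ra 1 (-1) (-2) (-2), ra 2 (-1) (-2) (-2), ra 0 0 (-2) (-2),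
   ra 2 (-2) (-2) (-2), rc 0 (-2) (-2) 0 2 (-2) 2 0, ra 2 (-2) (-4) 0, ra 2 (-2) (-3) (-1),
   ra 2 (-2) (-3) (-2), ra 2 (-2) (-4) (-1), rb 1 (-2) (-2) 0, rb 1 (-1) (-2) 0,
   rb 0 (-1) (-2) 0, rb 0 (-2) (-2) 0, rb 2 (-2) (-2) 0, rb 0 0 (-2) 0, rb 2 0 (-2) (-2),
   rb 0 0 0 (-2), rb 0 0 (-1) (-1), rb 0 0 (-1) 0, rb 0 0 0 (-1), rc 0 (-2) (-2) 0 1 0 0 0,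
   rc 0 (-2) (-2) 0 2 (-1) 0 0, rc 0 (-2) (-2) 0 1 (-1) 0 0, rc 0 (-2) (-2) 0 2 0 0 0,
   rc 0 (-2) (-2) 0 2 (-2) 0 0, rc 0 (-2) (-2) 0 2 (-2) 0 2, rc 0 (-2) (-2) 0 2 (-2) 0 1,
   rc 0 (-2) (-2) 0 2 (-2) 1 0, rc 0 (-2) (-2) 0 2 (-2) 1 1]

def row (i : Fin 61) : Row := RL.getD i []

def alt47 : Row := rc 0 (-2) (-2) 0 4 (-2) (-2) 2

def alt36 : Row := ra 2 (-2) (-4) (-2)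

def reps (i : Fin 61) : List Row :=
  if i = 47 then [row i, alt47] else if i = 36 then [row i, alt36] else [row i]

/-- the edges -/
def EL : List (Fin 61 × Fin 61) :=
  [(0, 1), (0, 2), (0, 3), (0, 19), (1, 2), (1, 5), (1, 19), (2, 3), (2, 5), (3, 6), (3, 7),
   (4, 8), (4, 9), (4, 50), (4, 51), (5, 6), (5, 10), (6, 10), (6, 11), (7, 12), (7, 13),
   (7, 14), (8, 9), (8, 14), (8, 15), (9, 15), (9, 16), (10, 11), (10, 17), (11, 12), (11, 17),
   (12, 13), (12, 18), (13, 14), (13, 18), (14, 15), (15, 16), (16, 17), (16, 18), (17, 18),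
   (19, 29), (19, 30), (20, 21), (20, 22), (20, 23), (20, 24), (21, 22), (21, 24), (21, 25),
   (22, 23), (22, 25), (23, 34), (23, 37), (24, 26), (24, 27), (25, 28), (25, 29), (26, 27),
   (26, 31), (26, 33), (27, 28), (27, 30), (28, 29), (28, 30), (29, 30), (31, 32), (31, 33),
   (31, 34), (32, 33), (32, 34), (32, 35), (33, 35), (34, 37), (35, 38), (35, 39), (36, 39),
   (36, 40), (36, 59), (36, 60), (37, 38), (37, 40), (38, 39), (38, 40), (39, 40), (41, 42),
   (41, 43), (41, 44), (41, 45), (42, 43), (42, 45), (42, 46), (43, 44), (43, 46), (44, 52),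
   (44, 54), (45, 47), (45, 48), (46, 49), (46, 50), (47, 48), (47, 55), (47, 57), (48, 49),
   (48, 51), (49, 50), (49, 51), (50, 51), (52, 53), (52, 54), (52, 55), (53, 54), (53, 55),
   (53, 56), (54, 56), (55, 57), (56, 58), (56, 59), (57, 58), (57, 60), (58, 59), (58, 60),
   (59, 60)]

/-- rounded coordinates -/
def QL : List (ℤ × ℤ) :=
  [(39940, 19945), (39712, 29942), (31168, 24746), (31395, 14749), (0, 0), (30941, 34744),
   (29668, 24712), (28568, 5157), (10000, 0), (5000, 8660), (21745, 30814), (20423, 20902),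
   (28385, 15155), (19818, 9998), (20000, 0), (15000, 8660), (10000, 17321), (12500, 27003),
   (19635, 19997), (48484, 25140), (42119, -6402), (43590, 3489), (34289, -182), (32817, -10073),
   (51420, -2731), (35760, 9709), (61365, -1683), (55486, 6406), (45623, 8057), (42122, 17425),
   (51985, 15773), (52064, -5354), (50592, -15245), (59894, -11574), (42762, -9025),
   (58422, -21465), (45698, -36896), (38697, -18162), (48559, -19813), (52060, -29181),
   (42197, -27529), (12726, -29554), (8304, -20585), (2748, -28899), (7169, -37868),
   (18283, -21240), (-1674, -19930), (25862, -14717), (16423, -11415), (7374, -15672),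
   (-837, -9965), (8211, -5707), (14126, -30684), (23825, -33116), (16869, -40301),
   (21082, -23500), (26569, -42733), (31079, -23248), (28824, -32990), (36133, -39814),
   (38388, -30072)]

def qq (i : Fin 61) : ℤ × ℤ := QL.getD i (0, 0)

def near (z : ℂ) (q : ℤ × ℤ) : Prop := |z.re * 10000 - q.1| ≤ 1 ∧ |z.im * 10000 - q.2| ≤ 1

def lin (f q : ℤ × ℤ) : ℤ := f.1 * q.1 + f.2 * q.2

def lt4 (f p q : ℤ × ℤ) : Bool := decide (lin f p + 2 * (nab f.1 + nab f.2) < lin f q)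

noncomputable def Lr (f : ℤ × ℤ) (z : ℂ) : ℝ := f.1 * z.re + f.2 * z.im

theorem Lr_near {z : ℂ} {q : ℤ × ℤ} (f : ℤ × ℤ) (h : near z q) :
    |Lr f z * 10000 - lin f q| ≤ |(f.1 : ℝ)| + |(f.2 : ℝ)| := by
  have e : Lr f z * 10000 - lin f q
      = f.1 * (z.re * 10000 - q.1) + f.2 * (z.im * 10000 - q.2) := by
    simp only [Lr, lin]; push_cast; ring
  rw [e]
  refine (abs_add_le _ _).trans (add_le_add ?_ ?_)
  · rw [abs_mul]; exact mul_le_of_le_one_right (abs_nonneg _) h.1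
  · rw [abs_mul]; exact mul_le_of_le_one_right (abs_nonneg _) h.2

theorem lt4_Lr {z w : ℂ} {p q f : ℤ × ℤ} (hz : near z p) (hw : near w q)
    (h : lt4 f p q = true) : Lr f z < Lr f w := by
  have h1 : ((lin f p + 2 * (nab f.1 + nab f.2) : ℤ) : ℝ) < (lin f q : ℤ) := by
    exact_mod_cast of_decide_eq_true h
  push_cast at h1
  rw [nab_eq, nab_eq] at h1
  have h2 := abs_le.mp (Lr_near f hz)
  have h3 := abs_le.mp (Lr_near f hw)
  linarith [h2.2, h3.1]

theorem Lr_comb (f : ℤ × ℤ) (s t : ℝ) (a b : ℂ) :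
    Lr f (s • a + t • b) = s * Lr f a + t * Lr f b := by
  simp [Lr]; ring

def sep (f a b c d : ℤ × ℤ) : Bool := lt4 f a c && lt4 f a d && lt4 f b c && lt4 f b d

theorem sep_false {a b c d x : ℂ} {qa qb qc qd f : ℤ × ℤ} (ha : near a qa) (hb : near b qb)
    (hc : near c qc) (hd : near d qd) (h : sep f qa qb qc qd = true)
    (h1 : x ∈ segment ℝ a b) (h2 : x ∈ segment ℝ c d) : False := by
  simp only [sep, Bool.and_eq_true] at h
  obtain ⟨⟨⟨hac, had⟩, hbc⟩, hbd⟩ := h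
  have hac := lt4_Lr ha hc hac
  have had := lt4_Lr ha hd had
  have hbc := lt4_Lr hb hc hbc
  have hbd := lt4_Lr hb hd hbd
  obtain ⟨s, t, hs, ht, hst, rfl⟩ := h1
  obtain ⟨s', t', hs', ht', hst', he⟩ := h2
  have he := congrArg (Lr f) he
  rw [Lr_comb, Lr_comb] at he
  have u1 : s * Lr f a + t * Lr f b ≤ max (Lr f a) (Lr f b) := by
    have e1 := mul_le_mul_of_nonneg_left (le_max_left (Lr f a) (Lr f b)) hs
    have e2 := mul_le_mul_of_nonneg_left (le_max_right (Lr f a) (Lr f b)) ht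
    calc _ ≤ _ := add_le_add e1 e2
      _ = (s + t) * max (Lr f a) (Lr f b) := by ring
      _ = _ := by rw [hst, one_mul]
  have u2 : min (Lr f c) (Lr f d) ≤ s' * Lr f c + t' * Lr f d := by
    have e1 := mul_le_mul_of_nonneg_left (min_le_left (Lr f c) (Lr f d)) hs'
    have e2 := mul_le_mul_of_nonneg_left (min_le_right (Lr f c) (Lr f d)) ht'
    calc _ = (s' + t') * min (Lr f c) (Lr f d) := by rw [hst', one_mul]
      _ = _ := by ring
      _ ≤ _ := add_le_add e1 e2
  have u3 : max (Lr f a) (Lr f b) < min (Lr f c) (Lr f d) :=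
    max_lt (lt_min hac had) (lt_min hbc hbd)
  linarith

theorem share_eq {v b d x : ℂ} {qv qb qd f : ℤ × ℤ} (hv : near v qv) (hb : near b qb)
    (hd : near d qd) (h : (lt4 f qb qv && lt4 f qv qd) = true)
    (h1 : x ∈ segment ℝ v b) (h2 : x ∈ segment ℝ v d) : x = v := by
  rw [Bool.and_eq_true] at h
  have hbv := lt4_Lr hb hv h.1
  have hvd := lt4_Lr hv hd h.2
  obtain ⟨s, t, hs, ht, hst, rfl⟩ := h1
  obtain ⟨s', t', hs', ht', hst', he⟩ := h2
  have he := congrArg (Lr f) he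
  rw [Lr_comb, Lr_comb] at he
  have e1 : s = 1 - t := by linarith
  have e2 : s' = 1 - t' := by linarith
  subst e1 e2
  have e3 : t' * (Lr f d - Lr f v) + t * (Lr f v - Lr f b) = 0 := by linear_combination he
  have n1 : 0 ≤ t' * (Lr f d - Lr f v) := mul_nonneg ht' (by linarith)
  have n2 : 0 ≤ t * (Lr f v - Lr f b) := mul_nonneg ht (by linarith)
  have n3 : t * (Lr f v - Lr f b) = 0 := by linarith
  have n4 : t = 0 := by
    rcases mul_eq_zero.mp n3 with h | h
    · exact h
    · linarith
  subst n4
  simp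

def sepAny (a b c d : ℤ × ℤ) : Bool :=
  sep (1, 0) a b c d || sep (-1, 0) a b c d || sep (0, 1) a b c d || sep (0, -1) a b c d ||
  sep (a.2 - b.2, b.1 - a.1) a b c d || sep (b.2 - a.2, a.1 - b.1) a b c d

def shareAny (v b d : ℤ × ℤ) : Bool :=
  let f := (d.1 - b.1, d.2 - b.2)
  let g := (2 * v.2 - b.2 - d.2, b.1 + d.1 - 2 * v.1)
  let g' := (b.2 + d.2 - 2 * v.2, 2 * v.1 - b.1 - d.1)
  (lt4 f b v && lt4 f v d) || (lt4 g b v && lt4 g v d) || (lt4 g' b v && lt4 g' v d)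

theorem sepAny_false {a b c d x : ℂ} {qa qb qc qd : ℤ × ℤ} (ha : near a qa) (hb : near b qb)
    (hc : near c qc) (hd : near d qd) (h : sepAny qa qb qc qd = true)
    (h1 : x ∈ segment ℝ a b) (h2 : x ∈ segment ℝ c d) : False := by
  simp only [sepAny, Bool.or_eq_true] at h
  rcases h with ((((h | h) | h) | h) | h) | h <;> exact sep_false ha hb hc hd h h1 h2

theorem shareAny_eq {v b d x : ℂ} {qv qb qd : ℤ × ℤ} (hv : near v qv) (hb : near b qb)
    (hd : near d qd) (h : shareAny qv qb qd = true)
    (h1 : x ∈ segment ℝ v b) (h2 : x ∈ segment ℝ v d) : x = v := by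
  simp only [shareAny] at h
  rw [Bool.or_eq_true, Bool.or_eq_true] at h
  rcases h with (h | h) | h <;> exact share_eq hv hb hd h h1 h2

theorem seg_sw {x a b : ℂ} (h : x ∈ segment ℝ a b) : x ∈ segment ℝ b a := by
  rwa [segment_symm]

def chk (e f : Fin 61 × Fin 61) : Bool :=
  if e.1 = f.1 then
    if e.2 = f.2 then true else shareAny (qq e.1) (qq e.2) (qq f.2)
  else if e.2 = f.2 then shareAny (qq e.2) (qq e.1) (qq f.1)
  else if e.1 = f.2 then shareAny (qq e.1) (qq e.2) (qq f.1)
  else if e.2 = f.1 then shareAny (qq e.2) (qq e.1) (qq f.2)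
  else sepAny (qq e.1) (qq e.2) (qq f.1) (qq f.2)

theorem chk_spec {z : Fin 61 → ℂ} (hz : ∀ i, near (z i) (qq i)) {e f : Fin 61 × Fin 61}
    (h : chk e f = true) (hne : e ≠ f) {x : ℂ} (h1 : x ∈ segment ℝ (z e.1) (z e.2))
    (h2 : x ∈ segment ℝ (z f.1) (z f.2)) :
    (x = z e.1 ∨ x = z e.2) ∧ (x = z f.1 ∨ x = z f.2) := by
  unfold chk at h
  split_ifs at h with c1 c2 c3 c4 c5
  · exact absurd (Prod.ext c1 c2) hne
  · rw [← c1] at h2 ⊢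
    have := shareAny_eq (hz _) (hz _) (hz _) h h1 h2
    exact ⟨Or.inl this, Or.inl this⟩
  · rw [← c3] at h2 ⊢
    have := shareAny_eq (hz _) (hz _) (hz _) h (seg_sw h1) (seg_sw h2)
    exact ⟨Or.inr this, Or.inr this⟩
  · rw [← c4] at h2 ⊢
    have := shareAny_eq (hz _) (hz _) (hz _) h h1 (seg_sw h2)
    exact ⟨Or.inl this, Or.inr this⟩
  · rw [← c5] at h2 ⊢
    have := shareAny_eq (hz _) (hz _) (hz _) h (seg_sw h1) h2
    exact ⟨Or.inr this, Or.inl this⟩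
  · exact (sepAny_false (hz _) (hz _) (hz _) (hz _) h h1 h2).elim

def pairs : List (Fin 61 × Fin 61) → Bool
  | [] => true
  | e :: l => l.all (chk e) && pairs l

theorem pairs_spec {L : List (Fin 61 × Fin 61)} (h : pairs L = true) {e f : Fin 61 × Fin 61}
    (he : e ∈ L) (hf : f ∈ L) (hne : e ≠ f) : chk e f = true ∨ chk f e = true := by
  induction L with
  | nil => simp at he
  | cons a l ih =>
    simp only [pairs, Bool.and_eq_true, List.all_eq_true] at h
    rcases List.mem_cons.mp he with rfl | he' <;> rcases List.mem_cons.mp hf with rfl | hf'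
    · exact absurd rfl hne
    · exact Or.inl (h.1 _ hf')
    · exact Or.inr (h.1 _ he')
    · exact ih h.2 he' hf'

theorem all_chk : pairs EL = true := by decide +kernel

def inj2 (p q : ℤ × ℤ) : Bool :=
  lt4 (1, 0) p q || lt4 (1, 0) q p || lt4 (0, 1) p q || lt4 (0, 1) q p

theorem inj2_ne {z w : ℂ} {p q : ℤ × ℤ} (hz : near z p) (hw : near w q) (h : inj2 p q = true) :
    z ≠ w := by
  rintro rfl
  simp only [inj2, Bool.or_eq_true] at h
  rcases h with ((h | h) | h) | h
  · exact lt_irrefl _ (lt4_Lr hz hw h)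
  · exact lt_irrefl _ (lt4_Lr hw hz h)
  · exact lt_irrefl _ (lt4_Lr hz hw h)
  · exact lt_irrefl _ (lt4_Lr hw hz h)

theorem all_inj : ∀ i j : Fin 61, i = j ∨ inj2 (qq i) (qq j) = true := by decide +kernel

noncomputable def pz (i : Fin 61) : ℂ := val (row i) ZS

theorem near_chk : ∀ i : Fin 61,
    apc (row i) BS ((qq i).1 * 100000000) ((qq i).2 * 100000000) 100000000 = true := by
  decide +kernel

theorem near_of_Ap {x : ℝ} {q : ℤ} (h : Ap x (q * 100000000) 100000000) :
    |x * 10000 - q| ≤ 1 := by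
  unfold Ap at h
  rw [abs_le] at *
  norm_num [SC] at h
  constructor <;> linarith [h.1, h.2]

theorem pz_near (i : Fin 61) : near (pz i) (qq i) := by
  have h := val_CA ZB (row i) _ _ _ (near_chk i)
  exact ⟨near_of_Ap h.1, near_of_Ap h.2⟩

theorem pz_inj : Function.Injective pz := by
  intro i j h
  rcases all_inj i j with e | e
  · exact e
  · exact absurd h (inj2_ne (pz_near i) (pz_near j) e)

/-! Exact relations. -/

theorem norm_one_of_nsq {z : ℂ} (h : Complex.normSq z = 1) : ‖z‖ = 1 := by
  rw [Complex.norm_def, h, Real.sqrt_one]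

theorem s15 : Real.sqrt 15 * Real.sqrt 15 = 15 := Real.mul_self_sqrt (by norm_num)

theorem kp_norm : ‖kp‖ = 1 := by
  apply norm_one_of_nsq
  rw [kp, Complex.normSq_mk]
  linear_combination (1 / 64) * s15

theorem kb_norm : ‖kb‖ = 1 := by rw [kb, Complex.norm_conj, kp_norm]

theorem kp1_norm : ‖2 * (1 - kp)‖ = 1 := by
  apply norm_one_of_nsq
  have e : 2 * (1 - kp) = ⟨1 / 4, -Real.sqrt 15 / 4⟩ := by
    apply Complex.ext <;> simp [kp] <;> ring
  rw [e, Complex.normSq_mk]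
  linear_combination (1 / 16) * s15

theorem kb1_norm : ‖2 * (1 - kb)‖ = 1 := by
  have : 2 * (1 - kb) = (starRingEnd ℂ) (2 * (1 - kp)) := by
    rw [map_mul, map_sub, map_one, map_ofNat, kb]
  rw [this, Complex.norm_conj, kp1_norm]

theorem om1_norm : ‖1 - om‖ = 1 := by rw [← om_conj, Complex.norm_conj, om_norm]

theorem sk1 : Real.sqrt (1191 / 1636) * Real.sqrt (1191 / 1636) = 1191 / 1636 :=
  Real.mul_self_sqrt (by norm_num)

theorem sg_norm : ‖sg‖ = 1 := by
  apply norm_one_of_nsq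
  rw [sg, Complex.normSq_mul, Complex.normSq_mk, Complex.normSq_mk, sk1]
  norm_num

theorem sg1_norm : ‖1 - hI - sg‖ = 1 := by
  apply norm_one_of_nsq
  have e : 1 - hI - sg = ⟨1, -3 / 20⟩ * ⟨1 / 2, -Real.sqrt (1191 / 1636)⟩ := by
    apply Complex.ext <;> simp [hI, sg] <;> ring
  rw [e, Complex.normSq_mul, Complex.normSq_mk, Complex.normSq_mk, neg_mul_neg, sk1]
  norm_num

theorem n_b_pos : 0 < Complex.normSq v_b := a_n_b.pos (by decide +kernel)
theorem n_d_pos : 0 < Complex.normSq v_d := a_n_d.pos (by decide +kernel)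
theorem n_e_pos : 0 < Complex.normSq v_e := a_n_e.pos (by decide +kernel)
theorem J2_pos : 0 < JJ + JJ := a_J2.pos (by decide +kernel)

theorem z_circ : Complex.normSq v_z = Complex.normSq v_b ∧ Complex.normSq (v_z - v_A) = 1 := by
  have hy : 0 < cy2 v_A (Complex.normSq v_b) 1 := a_p6.pos (by decide +kernel)
  have hA : 0 < Complex.normSq v_A := a_n_A.pos (by decide +kernel)
  unfold v_z
  apply circ hA
  simp only [Real.mul_self_sqrt hy.le]

theorem C_circ : Complex.normSq v_C = pp ∧ Complex.normSq (v_C - v_D) = Complex.normSq v_d := by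
  have hy : 0 < cy2 v_D pp (Complex.normSq v_d) := a_q6.pos (by decide +kernel)
  have hA : 0 < Complex.normSq v_D := a_n_D.pos (by decide +kernel)
  unfold v_C
  apply circ hA
  simp only [neg_mul_neg, Real.mul_self_sqrt hy.le]

theorem rr_norm : ‖rr‖ = 1 := by
  apply norm_one_of_nsq
  have h := n_b_pos
  rw [rr, Complex.normSq_div, Complex.normSq_mul, Complex.normSq_conj, Complex.normSq_ofReal,
    z_circ.1]
  field_simp

theorem rr_mul : v_b * rr = v_z := by
  have h : (Complex.normSq v_b : ℂ) ≠ 0 := by exact_mod_cast n_b_pos.ne'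
  rw [rr, mul_div_assoc', div_eq_iff h, ← Complex.mul_conj]
  ring

theorem ua_norm : ‖ua‖ = 1 := by
  apply norm_one_of_nsq
  have h := n_d_pos
  rw [ua, Complex.normSq_div, Complex.normSq_mul, Complex.normSq_conj, Complex.normSq_ofReal,
    C_circ.2]
  field_simp

theorem ua_mul : v_d * ua = v_C - v_D := by
  have h : (Complex.normSq v_d : ℂ) ≠ 0 := by exact_mod_cast n_d_pos.ne'
  rw [ua, mul_div_assoc', div_eq_iff h, ← Complex.mul_conj]
  ring

theorem ub_norm : ‖ub‖ = 1 := by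
  apply norm_one_of_nsq
  have h := n_e_pos
  have h2 := J2_pos
  rw [ub, Complex.normSq_div, Complex.normSq_mul, Complex.normSq_mul, Complex.normSq_conj,
    Complex.normSq_ofReal, C_circ.1, Complex.normSq_I, pp]
  generalize JJ + JJ = j at h2
  field_simp

theorem uc_norm : ‖uc‖ = 1 := by
  apply norm_one_of_nsq
  have h := n_e_pos
  have h2 := J2_pos
  rw [uc, Complex.normSq_div, Complex.normSq_mul, Complex.normSq_mul,
    Complex.normSq_ofReal, C_circ.1, Complex.normSq_I, pp]
  generalize JJ + JJ = j at h2
  field_simp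

theorem J2_ne : ((JJ + JJ : ℝ) : ℂ) ≠ 0 := by exact_mod_cast J2_pos.ne'

theorem cl47 : v_e * ub = (starRingEnd ℂ) v_e * uc := by
  rw [ub, uc]; ring

theorem cl36 : v_g * ub - (starRingEnd ℂ) v_g * uc = v_C := by
  have h := J2_ne
  have e : v_g * (starRingEnd ℂ) v_e - (starRingEnd ℂ) v_g * v_e
      = -(((JJ + JJ : ℝ) : ℂ) * Complex.I) := by
    have e1 : (starRingEnd ℂ) v_g * v_e = (starRingEnd ℂ) (v_g * (starRingEnd ℂ) v_e) := by simp
    rw [e1, Complex.sub_conj, JJ]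
    push_cast
    ring
  have e2 : v_g * ub - (starRingEnd ℂ) v_g * uc
      = Complex.I * v_C * (v_g * (starRingEnd ℂ) v_e - (starRingEnd ℂ) v_g * v_e)
        / ((JJ + JJ : ℝ) : ℂ) := by
    rw [ub, uc]; ring
  rw [e2, e, div_eq_iff h]
  linear_combination (-v_C * ((JJ + JJ : ℝ) : ℂ)) * Complex.I_mul_I

theorem alt47_eq : val alt47 ZS = pz 47 := by
  have h := cl47
  have e : pz 47 = val (rb 2 0 (-2) (-2)) ZS := rfl
  rw [e]
  simp only [v_e, val, map_add, map_mul, map_intCast, map_one, map_zero, om_conj] at h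
  rw [show (starRingEnd ℂ) kp = kb from rfl] at h
  simp only [alt47, rb, rc, ZS, val]
  push_cast at h ⊢
  linear_combination -h

theorem alt36_eq : val alt36 ZS = pz 36 := by
  have h := cl36
  have h2 := ua_mul
  have e : pz 36 = val (rc 0 (-2) (-2) 0 2 (-2) 2 0) ZS := rfl
  rw [e]
  rw [← h] at h2
  simp only [v_d, v_D, v_g, val, map_add, map_mul, map_intCast, map_one, map_zero, om_conj] at h2
  rw [show (starRingEnd ℂ) kp = kb from rfl] at h2
  simp only [alt36, ra, rc, ZS, val]
  push_cast at h2 ⊢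
  linear_combination h2

def gens : List Row :=
  [r0 1 0 0 0 0 0 0 0 0 0, r0 0 0 1 0 0 0 0 0 0 0, r0 0 0 0 0 1 0 0 0 0 0, r0 0 0 0 0 0 0 0 0 1 0,
   rsub (ra 1 0 0 0) (ra 0 0 0 0), rsub (ra 0 0 1 0) (ra 0 0 0 0),
   rb 1 0 0 0, rb 0 0 1 0, rc 0 0 0 0 1 0 0 0, rc 0 0 0 0 0 0 1 0,
   r0 2 (-2) (-2) 2 0 0 0 0 0 0, r0 0 0 0 0 1 0 (-1) 0 (-1) 0,
   rsub (ra (-2) 2 2 (-2)) (ra 0 0 0 0), rb (-2) 2 2 (-2), rc 0 0 0 0 0 (-2) 0 2,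
   r0 0 2 (-2) (-1) (-1) 0 (-1) 0 (-1) (-1)]

theorem nm1 (x : ℂ) (hx : ‖x‖ = 1) : ‖(1 - om) * (2 * (1 - kp)) * x‖ = 1 := by
  rw [norm_mul, norm_mul, om1_norm, kp1_norm, hx]; norm_num

theorem gens_norm : ∀ g ∈ gens, ‖val g ZS‖ = 1 := by
  intro g hg
  simp only [gens, List.mem_cons, List.not_mem_nil, or_false] at hg
  rcases hg with rfl | rfl | rfl | rfl | rfl | rfl | rfl | rfl | rfl | rfl | rfl | rfl | rfl | rfl | rfl | rfl
  · simp [r0, ZS, val]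
  · simp [r0, ZS, val, kb_norm]
  · simp [r0, ZS, val, rr_norm]
  · simp [r0, ZS, val, rr_norm, sg_norm]
  · simp [rsub, ra, ZS, val, ua_norm]
  · simp [rsub, ra, ZS, val, ua_norm, kp_norm]
  · simp [rb, rc, ZS, val, ub_norm]
  · simp [rb, rc, ZS, val, ub_norm, kp_norm]
  · simp [rc, ZS, val, uc_norm]
  · simp [rc, ZS, val, uc_norm, kb_norm]
  · have e : val (r0 2 (-2) (-2) 2 0 0 0 0 0 0) ZS = (1 - om) * (2 * (1 - kb)) := by
      simp only [r0, ZS, val]; push_cast; ring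
    rw [e, norm_mul, om1_norm, kb1_norm, one_mul]
  · have e : val (r0 0 0 0 0 1 0 (-1) 0 (-1) 0) ZS = (1 - hI - sg) * rr := by
      simp only [r0, ZS, val]; push_cast; ring
    rw [e, norm_mul, sg1_norm, rr_norm, one_mul]
  · have e : val (rsub (ra (-2) 2 2 (-2)) (ra 0 0 0 0)) ZS
        = -((1 - om) * (2 * (1 - kp)) * ua) := by
      rw [val_sub]; simp only [ra, ZS, val]; push_cast; ring
    rw [e, norm_neg, nm1 _ ua_norm]
  · have e : val (rb (-2) 2 2 (-2)) ZS = -((1 - om) * (2 * (1 - kp)) * ub) := by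
      simp only [rb, rc, ZS, val]; push_cast; ring
    rw [e, norm_neg, nm1 _ ub_norm]
  · have e : val (rc 0 0 0 0 0 (-2) 0 2) ZS = -(om * (2 * (1 - kb)) * uc) := by
      simp only [rc, ZS, val]; push_cast; ring
    rw [e, norm_neg, norm_mul, norm_mul, om_norm, kb1_norm, uc_norm]; norm_num
  · have e : val (r0 0 2 (-2) (-1) (-1) 0 (-1) 0 (-1) (-1)) ZS = v_z - v_A := by
      rw [← rr_mul]
      simp only [r0, ZS, val, v_b, v_A]; push_cast; ring
    rw [e]; exact norm_one_of_nsq z_circ.2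

theorem reps_val {i : Fin 61} {p : Row} (h : p ∈ reps i) : val p ZS = pz i := by
  unfold reps at h
  split_ifs at h with h1 h2
  · subst h1
    rcases List.mem_cons.mp h with rfl | h
    · rfl
    · rw [List.mem_singleton.mp h, alt47_eq]
  · subst h2
    rcases List.mem_cons.mp h with rfl | h
    · rfl
    · rw [List.mem_singleton.mp h, alt36_eq]
  · rw [List.mem_singleton.mp h]; rfl

def romn : ℕ → Row → Row
  | 0, l => l
  | n + 1, l => romn n (rom l)

theorem norm_romn (n : ℕ) (l : Row) (zs : List ℂ) : ‖val (romn n l) zs‖ = ‖val l zs‖ := by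
  induction n generalizing l with
  | zero => rfl
  | succ n ih => rw [romn, ih, norm_rom]

/-- which generator and which rotation each edge uses -/
def HL : List ℕ :=
  [15, 14, 13, 16, 13, 14, 17, 12, 15, 0, 90, 3, 2, 42, 47, 0, 66, 21, 20, 7, 6, 11, 1, 3, 2, 3,
   2, 19, 20, 0, 21, 11, 6, 10, 7, 1, 1, 62, 63, 64, 30, 35, 26, 25, 24, 27, 24, 28, 25, 29, 26,
   76, 77, 76, 75, 34, 33, 74, 24, 29, 31, 32, 32, 33, 34, 29, 28, 24, 27, 25, 28, 29, 72, 31,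
   30, 33, 32, 54, 55, 34, 35, 35, 30, 31, 38, 37, 36, 39, 36, 40, 37, 41, 38, 51, 52, 82, 81,
   46, 45, 80, 89, 88, 43, 44, 44, 45, 46, 52, 53, 51, 48, 50, 53, 52, 87, 56, 57, 59, 58, 58,
   57, 56]

def hint (e : Fin 61 × Fin 61) : ℕ := ((EL.zip HL).lookup e).getD 0

def unitn (n : ℕ) (e : Fin 61 × Fin 61) : Bool :=
  let g := gens.getD (n / 6) []
  decide (g ∈ gens) &&
  (reps e.1).any fun p => (reps e.2).any fun q => romn (n % 6) (rsub p q) == g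

def unitc (e : Fin 61 × Fin 61) : Bool := unitn (hint e) e

def exc (e : Fin 61 × Fin 61) : Bool := e == (3, 6) || e == (5, 6) || e == (11, 12)

theorem unit_chk : (EL.all fun e => exc e || unitc e) = true := by decide +kernel

theorem unitc_norm {e : Fin 61 × Fin 61} (h : unitc e = true) : ‖pz e.1 - pz e.2‖ = 1 := by
  simp only [unitc, unitn, Bool.and_eq_true, decide_eq_true_eq, List.any_eq_true, beq_iff_eq] at h
  obtain ⟨hg, p, hp, q, hq, h⟩ := h
  rw [← reps_val hp, ← reps_val hq, ← val_sub, ← norm_romn (hint e % 6), h, gens_norm _ hg]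

theorem hr_norm (a : ℝ) (ha : a * a = 1) : ‖((a : ℂ) - hI) * rr‖ = Real.sqrt (409 / 400) := by
  rw [norm_mul, rr_norm, mul_one, Complex.norm_def]
  have e : (a : ℂ) - hI = ⟨a, -(3 / 20)⟩ := by
    apply Complex.ext <;> simp [hI]
  rw [e, Complex.normSq_mk, ha]
  norm_num

theorem d36 : ‖pz 3 - pz 6‖ = Real.sqrt (409 / 400) := by
  rw [← hr_norm (-1) (by norm_num)]
  congr 1
  have e1 : pz 3 = val (r0 2 2 (-2) 0 (-1) 0 (-1) 0 (-1) (-1)) ZS := rfl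
  have e2 : pz 6 = val (r0 2 2 (-2) 0 0 0 0 0 (-1) (-1)) ZS := rfl
  rw [e1, e2]
  simp only [r0, ZS, val]; push_cast; ring

theorem d56 : ‖pz 5 - pz 6‖ = Real.sqrt (409 / 400) := by
  rw [← hr_norm 1 (by norm_num)]
  congr 1
  have e1 : pz 5 = val (r0 2 2 (-2) 0 1 0 (-1) 0 (-1) (-1)) ZS := rfl
  have e2 : pz 6 = val (r0 2 2 (-2) 0 0 0 0 0 (-1) (-1)) ZS := rfl
  rw [e1, e2]
  simp only [r0, ZS, val]; push_cast; ring

theorem t1_gt : 1 < Real.sqrt (409 / 400) := by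
  rw [Real.lt_sqrt (by norm_num)]; norm_num

theorem t1_lt : Real.sqrt (409 / 400) < 1.02 := by
  rw [Real.sqrt_lt' (by norm_num)]; norm_num

theorem d12_apx : CA (pz 11 - pz 12) (-796230995823) (574613324598) 1000000 := by
  have h := val_CA ZB (rsub (row 11) (row 12)) (-796230995823) (574613324598) 1000000 (by decide +kernel)
  rwa [val_sub] at h

theorem d12_nsq : Ap (Complex.normSq (pz 11 - pz 12)) 964164271515 100000000 :=
  d12_apx.nsq _ _ (by decide +kernel)

theorem d12_lo : 0.98 < ‖pz 11 - pz 12‖ := by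
  have h := d12_nsq
  unfold Ap at h
  rw [abs_le] at h
  norm_num [SC] at h
  rw [Complex.norm_def, Real.lt_sqrt (by norm_num)]
  norm_num
  linarith [h.1]

theorem d12_hi : ‖pz 11 - pz 12‖ < 1 := by
  have h := d12_nsq
  unfold Ap at h
  rw [abs_le] at h
  norm_num [SC] at h
  rw [Complex.norm_def, Real.sqrt_lt' (by norm_num)]
  norm_num
  linarith [h.2]

theorem pz_dist {e : Fin 61 × Fin 61} (he : e ∈ EL) :
    ‖pz e.1 - pz e.2‖ = 1 ∧ exc e = false ∨ e = (3, 6) ∨ e = (5, 6) ∨ e = (11, 12) := by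
  have h := List.all_eq_true.mp unit_chk e he
  cases hx : exc e with
  | false =>
    rw [hx, Bool.false_or] at h
    exact Or.inl ⟨unitc_norm h, rfl⟩
  | true =>
    simp only [exc, Bool.or_eq_true, beq_iff_eq] at hx
    rcases hx with (hx | hx) | hx
    · exact Or.inr (Or.inl hx)
    · exact Or.inr (Or.inr (Or.inl hx))
    · exact Or.inr (Or.inr (Or.inr hx))

noncomputable def iso : ℂ ≃ₗᵢ[ℝ] EuclideanSpace ℝ (Fin 2) := Complex.orthonormalBasisOneI.repr

theorem EL_nodup : EL.Nodup := by decide +kernel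

theorem EL_deg : ∀ v : Fin 61, (EL.filter fun e => decide (e.1 = v ∨ e.2 = v)).length = 4 := by
  decide +kernel

theorem EL_lt : (EL.all fun e => decide (e.1 < e.2)) = true := by decide +kernel

theorem EL_len : EL.length = 122 := by decide +kernel

theorem EL_119 : (EL.filter fun e => !exc e).length = 119 := by decide +kernel

theorem EL_2 : (EL.filter fun e => e == (3, 6) || e == (5, 6)).length = 2 := by decide +kernel

theorem card_filt {α : Type} [DecidableEq α] {L : List α} (hL : L.Nodup) (p : α → Bool)
    (q : α → Prop) [DecidablePred q] (h : ∀ e ∈ L, (q e ↔ p e = true)) {n : ℕ}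
    (hn : (L.filter p).length = n) : (L.toFinset.filter q).card = n := by
  rw [← hn, ← List.toFinset_card_of_nodup (hL.filter p)]
  congr 1
  ext e
  simp only [Finset.mem_filter, List.mem_toFinset, List.mem_filter]
  constructor
  · rintro ⟨a, b⟩; exact ⟨a, (h e a).mp b⟩
  · rintro ⟨a, b⟩; exact ⟨a, (h e a).mpr b⟩

theorem near_matchstick_61 :
    ∃ (P : Fin 61 → EuclideanSpace ℝ (Fin 2)) (E : Finset (Fin 61 × Fin 61)),
      Function.Injective P ∧
      (∀ e ∈ E, e.1 < e.2) ∧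
      E.card = 122 ∧
      (∀ v : Fin 61, (E.filter (fun e => e.1 = v ∨ e.2 = v)).card = 4) ∧
      (∀ e ∈ E, ∀ f ∈ E, e ≠ f →
        ∀ x ∈ segment ℝ (P e.1) (P e.2) ∩ segment ℝ (P f.1) (P f.2),
          (x = P e.1 ∨ x = P e.2) ∧ (x = P f.1 ∨ x = P f.2)) ∧
      (E.filter (fun e => dist (P e.1) (P e.2) = 1)).card = 119 ∧
      (∃ t₁ t₂ : ℝ, |t₁ - 1| < 0.04 ∧ |t₂ - 1| < 0.02 ∧
        (E.filter (fun e => dist (P e.1) (P e.2) = t₁ ∧ dist (P e.1) (P e.2) ≠ 1)).card = 2 ∧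
        ∀ e ∈ E, dist (P e.1) (P e.2) = 1 ∨ dist (P e.1) (P e.2) = t₁ ∨
          dist (P e.1) (P e.2) = t₂) := by
  have hd : ∀ i j : Fin 61, dist (iso (pz i)) (iso (pz j)) = ‖pz i - pz j‖ := by
    intro i j
    rw [iso.dist_map, dist_eq_norm]
  have t1g := t1_gt
  have t1l := t1_lt
  have dlo := d12_lo
  have dhi := d12_hi
  refine ⟨fun i => iso (pz i), EL.toFinset, ?_, ?_, ?_, ?_, ?_, ?_, ?_⟩
  · exact iso.injective.comp pz_inj
  · intro e he
    exact of_decide_eq_true (List.all_eq_true.mp EL_lt e (List.mem_toFinset.mp he))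
  · exact (List.toFinset_card_of_nodup EL_nodup).trans EL_len
  · intro v
    exact card_filt EL_nodup _ _ (fun e _ => (decide_eq_true_iff).symm) (EL_deg v)
  · intro e he f hf hne x hx
    have hc := pairs_spec all_chk (List.mem_toFinset.mp he) (List.mem_toFinset.mp hf) hne
    obtain ⟨⟨s, t, hs, ht, hst, rfl⟩, ⟨s', t', hs', ht', hst', h2⟩⟩ := hx
    simp only [← map_smul, ← map_add] at h2 ⊢
    have h2 := iso.injective h2
    have k1 : s • pz e.1 + t • pz e.2 ∈ segment ℝ (pz e.1) (pz e.2) := ⟨s, t, hs, ht, hst, rfl⟩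
    have k2 : s • pz e.1 + t • pz e.2 ∈ segment ℝ (pz f.1) (pz f.2) :=
      ⟨s', t', hs', ht', hst', h2⟩
    have key : (s • pz e.1 + t • pz e.2 = pz e.1 ∨ s • pz e.1 + t • pz e.2 = pz e.2) ∧
        (s • pz e.1 + t • pz e.2 = pz f.1 ∨ s • pz e.1 + t • pz e.2 = pz f.2) := by
      rcases hc with hc | hc
      · exact chk_spec pz_near hc hne k1 k2
      · exact (chk_spec pz_near hc hne.symm k2 k1).symm
    simpa only [iso.injective.eq_iff] using key
  · refine card_filt EL_nodup _ _ ?_ EL_119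
    · intro e he
      simp only [hd]
      rcases pz_dist he with ⟨h1, h2⟩ | rfl | rfl | rfl
      · simp [h1, h2]
      · have : exc (3, 6) = true := by decide
        simp only [d36, this]
        simpa using t1g.ne'
      · have : exc (5, 6) = true := by decide
        simp only [d56, this]
        simpa using t1g.ne'
      · have : exc (11, 12) = true := by decide
        simp only [this]
        simpa using dhi.ne
  · refine ⟨Real.sqrt (409 / 400), ‖pz 11 - pz 12‖, ?_, ?_, ?_, ?_⟩
    · rw [abs_lt]; norm_num at *; constructor <;> linarith
    · rw [abs_lt]; norm_num at *; constructor <;> linarith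
    · refine card_filt EL_nodup _ _ ?_ EL_2
      · intro e he
        simp only [hd]
        rcases pz_dist he with ⟨h1, h2⟩ | rfl | rfl | rfl
        · simp only [exc, Bool.or_eq_false_iff] at h2
          simp [h1, h2.1.1, h2.1.2]
        · simpa [d36] using t1g.ne'
        · simpa [d56] using t1g.ne'
        · have hne : ‖pz 11 - pz 12‖ ≠ Real.sqrt (409 / 400) := by
            intro h
            linarith
          constructor
          · intro h
            exact absurd h.1 hne
          · intro h
            exact absurd h (by decide)
    · intro e he
      simp only [hd]
      rcases pz_dist (List.mem_toFinset.mp he) with ⟨h1, h2⟩ | rfl | rfl | rfl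
      · exact Or.inl h1
      · exact Or.inr (Or.inl d36)
      · exact Or.inr (Or.inl d56)
      · exact Or.inr (Or.inr rfl)
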